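/- arXiv:1312.4468 — 3 statements merged into one kernel-verified Lean document; each statement's English description precedes it below -/
import Mathlib

section
/- (Lemma 8.) Fix ρ ∈ (−1, 0). Let W be a B-DMC with finite output alphabet, ε ∈ [0, 1], x ∈ [0, 1/2]. If E0(ρ, BSC_x) ≤ E0(ρ, W) ≤ E0(ρ, BEC_ε), then R(ρ, BEC_ε) ≤ R(ρ, W) ≤ R(ρ, BSC_x); moreover, if both hypothesis inequalities are strict, then both conclusion inequalities are strict. -/
/-- A binary-input discrete memoryless channel: a nonempty finite output alphabet `Y`
together with conditional probability mass functions `W0 = W(·|0)` and `W1 = W(·|1)`. -/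
structure BDMC where
  Y : Type
  [fin : Fintype Y]
  [ne : Nonempty Y]
  W0 : Y → ℝ
  W1 : Y → ℝ
  W0_nonneg : ∀ y, 0 ≤ W0 y
  W1_nonneg : ∀ y, 0 ≤ W1 y
  sum_W0 : ∑ y, W0 y = 1
  sum_W1 : ∑ y, W1 y = 1

attribute [instance] BDMC.fin BDMC.ne

/-- Gallager's `E₀` function of a B-DMC under the uniform input distribution:
`E₀(ρ, W) = −log ∑_y (½ W(y|0)^{1/(1+ρ)} + ½ W(y|1)^{1/(1+ρ)})^{1+ρ}`. -/
noncomputable def E0 (ρ : ℝ) (W : BDMC) : ℝ :=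
  -Real.log (∑ y, ((1/2) * W.W0 y ^ (1/(1+ρ)) + (1/2) * W.W1 y ^ (1/(1+ρ))) ^ (1+ρ))

/-- `E₀` of the binary erasure channel with erasure probability `ε`:
`E₀(ρ, BEC_ε) = −log(2^{−ρ}(1−ε) + ε)`. -/
noncomputable def E0bec (ρ ε : ℝ) : ℝ := -Real.log ((2:ℝ) ^ (-ρ) * (1-ε) + ε)

/-- `E₀` of the binary symmetric channel with crossover probability `x`:
`E₀(ρ, BSC_x) = −log(2^{−ρ}(x^{1/(1+ρ)} + (1−x)^{1/(1+ρ)})^{1+ρ})`. -/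
noncomputable def E0bsc (ρ x : ℝ) : ℝ :=
  -Real.log ((2:ℝ) ^ (-ρ) * (x ^ (1/(1+ρ)) + (1-x) ^ (1/(1+ρ))) ^ (1+ρ))

/-- `R(ρ, W)`: the derivative of `ρ ↦ E₀(ρ, W)` at `ρ`. -/
noncomputable def RW (ρ : ℝ) (W : BDMC) : ℝ := deriv (fun r => E0 r W) ρ

/-- `R(ρ, BEC_ε)`: the derivative of `ρ ↦ E₀(ρ, BEC_ε)` at `ρ`. -/
noncomputable def Rbec (ρ ε : ℝ) : ℝ := deriv (fun r => E0bec r ε) ρ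

/-- `R(ρ, BSC_x)`: the derivative of `ρ ↦ E₀(ρ, BSC_x)` at `ρ`. -/
noncomputable def Rbsc (ρ x : ℝ) : ℝ := deriv (fun r => E0bsc r x) ρ

open Real Set

/-- The sum `p ^ r + (1 - p) ^ r`. -/
noncomputable def binPowerSum (r p : ℝ) : ℝ := p ^ r + (1 - p) ^ r

lemma binPowerSum_one_sub (r p : ℝ) : binPowerSum r (1 - p) = binPowerSum r p := by
  simp [binPowerSum, add_comm]

lemma binPowerSum_zero {r : ℝ} (hr : r ≠ 0) : binPowerSum r 0 = 1 := by
  simp [binPowerSum, hr]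

lemma binPowerSum_half (r : ℝ) : binPowerSum r (1 / 2) = 2 ^ (1 - r) := by
  rw [binPowerSum, show (1 : ℝ) - 1 / 2 = 1 / 2 by norm_num, rpow_sub two_pos, rpow_one,
    one_div, inv_rpow two_pos.le]
  ring

lemma convexOn_sinh : ConvexOn ℝ (Ici 0) sinh := by
  refine MonotoneOn.convexOn_of_deriv (convex_Ici 0) continuous_sinh.continuousOn
    differentiable_sinh.differentiableOn ?_
  rw [Real.deriv_sinh, interior_Ici]
  intro a ha b hb hab
  rw [mem_Ioi] at ha hb
  rw [Real.cosh_le_cosh, abs_of_pos ha, abs_of_pos hb]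
  exact hab

lemma mul_sinh_mul_le {α x y : ℝ} (hα : 0 ≤ α) (hx : 0 ≤ x) (hxy : x ≤ y) :
    y * sinh (α * x) ≤ x * sinh (α * y) := by
  rcases hx.eq_or_lt with rfl | hx0
  · simp
  have hy : 0 < y := hx0.trans_le hxy
  have h := convexOn_sinh.2 (mem_Ici.2 (mul_nonneg hα hy.le)) (mem_Ici.2 (le_refl (0 : ℝ)))
    (div_nonneg hx hy.le) (sub_nonneg.2 ((div_le_one hy).2 hxy)) (add_sub_cancel _ _)
  have e : x / y * (α * y) = α * x := by field_simp
  simp only [smul_eq_mul, mul_zero, add_zero, sinh_zero, e] at h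
  calc y * sinh (α * x) ≤ y * (x / y * sinh (α * y)) := by gcongr
    _ = x * sinh (α * y) := by field_simp

lemma rpow_sub_rpow_eq_sinh {c p q : ℝ} (hp : 0 < p) (hq : 0 < q) :
    p ^ (-c) - q ^ (-c) = (p * q) ^ (-(c / 2)) * (2 * sinh (c / 2 * (log q - log p))) := by
  rw [sinh_eq, rpow_def_of_pos hp, rpow_def_of_pos hq, rpow_def_of_pos (mul_pos hp hq),
    log_mul hp.ne' hq.ne']
  have h : ∀ u v w : ℝ, exp u * (2 * ((exp v - exp w) / 2)) = exp (u + v) - exp (u + w) := by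
    intro u v w; rw [exp_add, exp_add]; ring
  rw [h]
  congr 2 <;> ring

lemma log_mul_rpow_sub_le {c p p' : ℝ} (hc : 0 ≤ c) (hp : 0 < p) (hpp : p ≤ p')
    (hp' : p' ≤ 1 / 2) :
    (log (1 - p) - log p) * (p' ^ (-c) - (1 - p') ^ (-c)) ≤
      (log (1 - p') - log p') * (p ^ (-c) - (1 - p) ^ (-c)) := by
  have h0 : 0 < p' := hp.trans_le hpp
  rw [rpow_sub_rpow_eq_sinh hp (by linarith), rpow_sub_rpow_eq_sinh h0 (by linarith)]
  have hL' : 0 ≤ log (1 - p') - log p' := sub_nonneg.2 (log_le_log h0 (by linarith))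
  have hLL : log (1 - p') - log p' ≤ log (1 - p) - log p :=
    sub_le_sub (log_le_log (by linarith) (by linarith)) (log_le_log hp hpp)
  have hs := mul_sinh_mul_le (α := c / 2) (by positivity) hL' hLL
  have hs0 : 0 ≤ sinh (c / 2 * (log (1 - p) - log p)) :=
    sinh_nonneg_iff.2 (mul_nonneg (by positivity) (hL'.trans hLL))
  have hpow : (p' * (1 - p')) ^ (-(c / 2)) ≤ (p * (1 - p)) ^ (-(c / 2)) :=
    rpow_le_rpow_of_nonpos (mul_pos hp (by linarith)) (by nlinarith) (by linarith)
  have hpos : 0 ≤ (p' * (1 - p')) ^ (-(c / 2)) :=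
    rpow_nonneg (mul_nonneg h0.le (by linarith)) _
  calc _ = 2 * (p' * (1 - p')) ^ (-(c / 2)) *
        ((log (1 - p) - log p) * sinh (c / 2 * (log (1 - p') - log p'))) := by ring
    _ ≤ 2 * (p' * (1 - p')) ^ (-(c / 2)) *
        ((log (1 - p') - log p') * sinh (c / 2 * (log (1 - p) - log p))) := by gcongr
    _ ≤ 2 * (p * (1 - p)) ^ (-(c / 2)) *
        ((log (1 - p') - log p') * sinh (c / 2 * (log (1 - p) - log p))) := by gcongr
    _ = _ := by ring

lemma mul_log_le_rpow_sub {c p : ℝ} (hc : 0 ≤ c) (hp : 0 < p) (hp' : p ≤ 1 / 2) :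
    c * (log (1 - p) - log p) ≤ p ^ (-c) - (1 - p) ^ (-c) := by
  rw [rpow_sub_rpow_eq_sinh hp (by linarith)]
  have hL : 0 ≤ log (1 - p) - log p := sub_nonneg.2 (log_le_log hp (by linarith))
  have h1 : 1 ≤ (p * (1 - p)) ^ (-(c / 2)) :=
    one_le_rpow_of_pos_of_le_one_of_nonpos (mul_pos hp (by linarith)) (by nlinarith)
      (by linarith)
  have h2 : c / 2 * (log (1 - p) - log p) ≤ sinh (c / 2 * (log (1 - p) - log p)) :=
    self_le_sinh_iff.2 (by positivity)
  have h3 : 0 ≤ c / 2 * (log (1 - p) - log p) := by positivity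
  nlinarith

lemma hasDerivAt_binEntropy_sub_binPowerSum {r m p : ℝ} (hp : 0 < p) (hp' : p < 1) :
    HasDerivAt (fun p => binEntropy p - m * binPowerSum r p)
      (log (1 - p) - log p - m * r * (p ^ (-(1 - r)) - (1 - p) ^ (-(1 - r)))) p := by
  have h1 := hasDerivAt_binEntropy hp.ne' hp'.ne
  have h2 : HasDerivAt (fun p : ℝ => p ^ r) (1 * r * p ^ (r - 1)) p :=
    (hasDerivAt_id p).rpow_const (Or.inl hp.ne')
  have h3 : HasDerivAt (fun p : ℝ => (1 - p) ^ r) (-1 * r * (1 - p) ^ (r - 1)) p :=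
    ((hasDerivAt_id p).const_sub 1).rpow_const (Or.inl (by simp; linarith))
  refine (h1.sub ((h2.add h3).const_mul m)).congr_deriv ?_
  rw [neg_sub]
  ring

/-- As a function of `p ^ r + (1 - p) ^ r`, the binary entropy has a supporting line with
positive slope at every `p₀ ∈ (0, 1/2]`. -/
lemma exists_binEntropy_support {r p₀ : ℝ} (hr : r ∈ Ioo (0 : ℝ) 1)
    (hp₀ : p₀ ∈ Ioc (0 : ℝ) (1 / 2)) :
    ∃ m > 0, ∀ p ∈ Icc (0 : ℝ) 1,
      binEntropy p₀ + m * (binPowerSum r p - binPowerSum r p₀) ≤ binEntropy p := by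
  obtain ⟨hr0, hr1⟩ := hr
  obtain ⟨h0, h1⟩ := hp₀
  obtain ⟨m, hm, hleft, hright⟩ : ∃ m > 0,
      (∀ p, 0 < p → p ≤ p₀ →
        log (1 - p) - log p ≤ m * r * (p ^ (-(1 - r)) - (1 - p) ^ (-(1 - r)))) ∧
      (∀ p, p₀ ≤ p → p < 1 / 2 →
        m * r * (p ^ (-(1 - r)) - (1 - p) ^ (-(1 - r))) ≤ log (1 - p) - log p) := by
    rcases h1.eq_or_lt with rfl | h1
    · refine ⟨1 / (r * (1 - r)), by have := sub_pos.2 hr1; positivity, ?_, ?_⟩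
      · intro p hp hp'
        have h := mul_log_le_rpow_sub (c := 1 - r) (by linarith) hp hp'
        have := sub_pos.2 hr1
        rw [show 1 / (r * (1 - r)) * r = 1 / (1 - r) by field_simp, one_div,
          inv_mul_eq_div, le_div_iff₀ this]
        linarith
      · intro p hp hp'; linarith
    · have hL : 0 < log (1 - p₀) - log p₀ := sub_pos.2 (log_lt_log h0 (by linarith))
      have hK : 0 < p₀ ^ (-(1 - r)) - (1 - p₀) ^ (-(1 - r)) :=
        sub_pos.2 (rpow_lt_rpow_of_neg h0 (by linarith) (by linarith))
      have e : ∀ K : ℝ, (log (1 - p₀) - log p₀) /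
          (r * (p₀ ^ (-(1 - r)) - (1 - p₀) ^ (-(1 - r)))) * r * K =
          (log (1 - p₀) - log p₀) * K / (p₀ ^ (-(1 - r)) - (1 - p₀) ^ (-(1 - r))) := by
        intro K; field_simp
      refine ⟨(log (1 - p₀) - log p₀) / (r * (p₀ ^ (-(1 - r)) - (1 - p₀) ^ (-(1 - r)))),
        by positivity, ?_, ?_⟩
      · intro p hp hp'
        rw [e, le_div_iff₀ hK]
        exact log_mul_rpow_sub_le (by linarith) hp hp' h1.le
      · intro p hp hp'
        rw [e, div_le_iff₀ hK]
        exact log_mul_rpow_sub_le (by linarith) h0 hp hp'.le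
  refine ⟨m, hm, ?_⟩
  have hcont : Continuous fun p => binEntropy p - m * binPowerSum r p := by
    unfold binPowerSum
    have h1 : Continuous fun p : ℝ => p ^ r := continuous_id.rpow_const fun _ => Or.inr hr0.le
    have h2 : Continuous fun p : ℝ => (1 - p) ^ r :=
      (continuous_const.sub continuous_id).rpow_const fun _ => Or.inr hr0.le
    fun_prop
  have hanti : AntitoneOn (fun p => binEntropy p - m * binPowerSum r p) (Icc 0 p₀) := by
    refine antitoneOn_of_deriv_nonpos (convex_Icc _ _) hcont.continuousOn ?_ ?_ <;>
      rw [interior_Icc] <;> rintro p ⟨hp, hp'⟩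
    · exact (hasDerivAt_binEntropy_sub_binPowerSum hp
        (by linarith)).differentiableAt.differentiableWithinAt
    · rw [(hasDerivAt_binEntropy_sub_binPowerSum hp (by linarith)).deriv]
      linarith [hleft p hp hp'.le]
  have hmono : MonotoneOn (fun p => binEntropy p - m * binPowerSum r p) (Icc p₀ (1 / 2)) := by
    refine monotoneOn_of_deriv_nonneg (convex_Icc _ _) hcont.continuousOn ?_ ?_ <;>
      rw [interior_Icc] <;> rintro p ⟨hp, hp'⟩
    · exact (hasDerivAt_binEntropy_sub_binPowerSum (by linarith)
        (by linarith)).differentiableAt.differentiableWithinAt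
    · rw [(hasDerivAt_binEntropy_sub_binPowerSum (by linarith) (by linarith)).deriv]
      linarith [hright p hp.le hp']
  have key : ∀ p ∈ Icc (0 : ℝ) (1 / 2),
      binEntropy p₀ + m * (binPowerSum r p - binPowerSum r p₀) ≤ binEntropy p := by
    rintro p ⟨hp, hp'⟩
    rcases le_total p p₀ with h | h
    · have := hanti ⟨hp, h⟩ ⟨h0.le, le_rfl⟩ h
      simp only at this
      linarith
    · have := hmono ⟨le_rfl, h1⟩ ⟨h, hp'⟩ h
      simp only at this
      linarith
  rintro p ⟨hp, hp'⟩
  rcases le_total p (1 / 2) with h | h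
  · exact key p ⟨hp, h⟩
  · rw [← binEntropy_one_sub p, ← binPowerSum_one_sub r p]
    exact key (1 - p) ⟨by linarith, by linarith⟩

/-- The chord bound for the binary entropy as a function of `p ^ r + (1 - p) ^ r`. -/
lemma binEntropy_mul_le {r p : ℝ} (hr : r ∈ Ioo (0 : ℝ) 1) (hp : p ∈ Icc (0 : ℝ) 1) :
    (2 ^ (1 - r) - 1) * binEntropy p ≤ log 2 * (binPowerSum r p - 1) := by
  have key : ∀ p ∈ Icc (0 : ℝ) (1 / 2),
      (2 ^ (1 - r) - 1) * binEntropy p ≤ log 2 * (binPowerSum r p - 1) := by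
    rintro p ⟨hp, hp'⟩
    rcases hp.eq_or_lt with rfl | hp
    · simp [binPowerSum_zero hr.1.ne']
    obtain ⟨m, hm, h⟩ := exists_binEntropy_support hr ⟨hp, hp'⟩
    have h1 := h 0 (by norm_num)
    have h2 := h (1 / 2) (by norm_num)
    rw [binPowerSum_half, one_div, binEntropy_two_inv] at h2
    rw [binPowerSum_zero hr.1.ne', binEntropy_zero] at h1
    have hH := binEntropy_nonneg hp.le (show p ≤ 1 by linarith)
    have hw1 : 1 ≤ binPowerSum r p := by nlinarith
    have hw2 : binPowerSum r p ≤ 2 ^ (1 - r) := by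
      have h := (concaveOn_rpow hr.1.le hr.2.le).2 (mem_Ici.2 hp.le)
        (mem_Ici.2 (show 0 ≤ 1 - p by linarith)) one_half_pos.le one_half_pos.le
        (add_halves (1 : ℝ))
      simp only [smul_eq_mul] at h
      rw [← mul_add, ← mul_add, add_sub_cancel, mul_one] at h
      rw [← binPowerSum_half, binPowerSum, binPowerSum, sub_half]
      linarith
    nlinarith [mul_le_mul_of_nonneg_left h2 (sub_nonneg.2 hw1),
      mul_le_mul_of_nonneg_left h1 (sub_nonneg.2 hw2)]
  rcases le_total p (1 / 2) with h | h
  · exact key p ⟨hp.1, h⟩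
  · rw [← binEntropy_one_sub p, ← binPowerSum_one_sub r p]
    exact key (1 - p) ⟨by linarith [hp.2], by linarith⟩

/-- The contribution of one output letter with likelihoods `a` and `b` to the sum inside the
logarithm of Gallager's function. -/
noncomputable def gallagerTerm (ρ a b : ℝ) : ℝ :=
  ((1 / 2) * a ^ (1 / (1 + ρ)) + (1 / 2) * b ^ (1 / (1 + ρ))) ^ (1 + ρ)

/-- The tilted posterior probability of the input `0`. -/
noncomputable def tiltedPosterior (ρ a b : ℝ) : ℝ :=
  a ^ (1 / (1 + ρ)) / (a ^ (1 / (1 + ρ)) + b ^ (1 / (1 + ρ)))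

section GallagerTerm

variable {ρ a b : ℝ}

lemma gallagerTerm_nonneg (ha : 0 ≤ a) (hb : 0 ≤ b) : 0 ≤ gallagerTerm ρ a b := by
  unfold gallagerTerm; positivity

lemma tiltedPosterior_mem_Icc (ha : 0 ≤ a) (hb : 0 ≤ b) :
    tiltedPosterior ρ a b ∈ Icc (0 : ℝ) 1 := by
  unfold tiltedPosterior
  exact ⟨by positivity, div_le_one_of_le₀ (le_add_of_nonneg_right (by positivity))
    (by positivity)⟩

lemma gallagerTerm_mul_binPowerSum (hρ : ρ ∈ Ioo (-1 : ℝ) 0) (ha : 0 ≤ a) (hb : 0 ≤ b) :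
    gallagerTerm ρ a b * binPowerSum (1 + ρ) (tiltedPosterior ρ a b) =
      2 ^ (-(1 + ρ)) * (a + b) := by
  have hr : 0 < 1 + ρ := by linarith [hρ.1]
  have hs : 1 / (1 + ρ) ≠ 0 := by positivity
  have hA : 0 ≤ a ^ (1 / (1 + ρ)) := by positivity
  have hB : 0 ≤ b ^ (1 / (1 + ρ)) := by positivity
  have hAr : (a ^ (1 / (1 + ρ))) ^ (1 + ρ) = a := by
    rw [← rpow_mul ha, one_div_mul_cancel hr.ne', rpow_one]
  have hBr : (b ^ (1 / (1 + ρ))) ^ (1 + ρ) = b := by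
    rw [← rpow_mul hb, one_div_mul_cancel hr.ne', rpow_one]
  unfold gallagerTerm tiltedPosterior binPowerSum
  generalize a ^ (1 / (1 + ρ)) = A at *
  generalize b ^ (1 / (1 + ρ)) = B at *
  rw [← hAr, ← hBr]
  rcases (add_nonneg hA hB).eq_or_lt with h | h
  · obtain rfl : A = 0 := by linarith
    obtain rfl : B = 0 := by linarith
    simp [hr.ne']
  · rw [one_sub_div h.ne', add_sub_cancel_left, ← mul_add, mul_rpow (by norm_num) h.le,
      div_rpow hA h.le, div_rpow hB h.le, one_div, inv_rpow two_pos.le, rpow_neg two_pos.le]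
    have : 0 < (A + B) ^ (1 + ρ) := by positivity
    field_simp

lemma hasDerivAt_rpow_one_div (hρ : -1 < ρ) (ha : 0 ≤ a) :
    HasDerivAt (fun r => a ^ (1 / (1 + r)))
      (-(a ^ (1 / (1 + ρ)) * log a) / (1 + ρ) ^ 2) ρ := by
  have hr : 0 < 1 + ρ := by linarith
  rcases ha.eq_or_lt with rfl | ha
  · have : (fun r : ℝ => (0 : ℝ) ^ (1 / (1 + r))) =ᶠ[nhds ρ] fun _ => 0 := by
      filter_upwards [Ioi_mem_nhds hρ] with r hr
      have : 0 < 1 + r := by linarith [mem_Ioi.1 hr]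
      exact zero_rpow (by positivity)
    simpa using (hasDerivAt_const ρ (0 : ℝ)).congr_of_eventuallyEq this
  · have h : HasDerivAt (fun r : ℝ => 1 / (1 + r)) (-1 / (1 + ρ) ^ 2) ρ := by
      simpa using ((hasDerivAt_id ρ).const_add 1).fun_inv hr.ne'
    refine (h.const_rpow ha).congr_deriv ?_
    ring

lemma hasDerivAt_gallagerTerm (hρ : -1 < ρ) (ha : 0 ≤ a) (hb : 0 ≤ b) :
    HasDerivAt (fun r => gallagerTerm r a b)
      (-(gallagerTerm ρ a b * (log 2 - binEntropy (tiltedPosterior ρ a b)))) ρ := by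
  have hr : 0 < 1 + ρ := by linarith
  rcases (add_nonneg ha hb).eq_or_lt with h | h
  · obtain rfl : a = 0 := by linarith
    obtain rfl : b = 0 := by linarith
    have hz : ∀ r ∈ Ioi (-1 : ℝ), gallagerTerm r 0 0 = 0 := by
      intro r hr
      have : 0 < 1 + r := by linarith [mem_Ioi.1 hr]
      rw [gallagerTerm, zero_rpow (by positivity)]
      simp [this.ne']
    have : (fun r : ℝ => gallagerTerm r 0 0) =ᶠ[nhds ρ] fun _ => 0 := by
      filter_upwards [Ioi_mem_nhds hρ] with r hr using hz r hr
    simpa [hz ρ hρ] using (hasDerivAt_const ρ (0 : ℝ)).congr_of_eventuallyEq this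
  · have hlogA : ∀ c : ℝ, 0 ≤ c → c ^ (1 / (1 + ρ)) * log c =
        c ^ (1 / (1 + ρ)) * ((1 + ρ) * log (c ^ (1 / (1 + ρ)))) := by
      intro c hc
      rcases hc.eq_or_lt with rfl | hc
      · simp [hr.ne']
      · rw [log_rpow hc]; field_simp
    have hA : 0 ≤ a ^ (1 / (1 + ρ)) := by positivity
    have hB : 0 ≤ b ^ (1 / (1 + ρ)) := by positivity
    have hS : 0 < a ^ (1 / (1 + ρ)) + b ^ (1 / (1 + ρ)) := by
      rcases ha.eq_or_lt with rfl | ha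
      · have : 0 < b := by linarith
        positivity
      · positivity
    have hF : 0 < (1 / 2) * a ^ (1 / (1 + ρ)) + (1 / 2) * b ^ (1 / (1 + ρ)) := by linarith
    have h := (((hasDerivAt_rpow_one_div hρ ha).const_mul (1 / 2)).add
      ((hasDerivAt_rpow_one_div hρ hb).const_mul (1 / 2))).rpow
      ((hasDerivAt_id ρ).const_add 1) hF
    refine h.congr_deriv ?_
    simp only [id, Pi.add_apply]
    rw [hlogA a ha, hlogA b hb]
    unfold gallagerTerm tiltedPosterior
    have hlog : ∀ u S : ℝ, 0 ≤ u → 0 < S →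
        u / S * log (u / S)⁻¹ = u / S * (log S - log u) := by
      intro u S hu hS
      rcases hu.eq_or_lt with rfl | hu
      · simp
      · rw [inv_div, log_div hS.ne' hu.ne']
    generalize a ^ (1 / (1 + ρ)) = A at *
    generalize b ^ (1 / (1 + ρ)) = B at *
    rw [binEntropy, hlog A _ hA hS, one_sub_div hS.ne', add_sub_cancel_left A B, hlog B _ hB hS,
      rpow_sub hF, rpow_one, ← mul_add (1 / 2) A B, log_mul (by norm_num) hS.ne', one_div,
      log_inv]
    generalize (2⁻¹ * (A + B)) ^ (1 + ρ) = G
    field_simp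
    ring

end GallagerTerm

lemma E0_eq (ρ : ℝ) (W : BDMC) : E0 ρ W = -log (∑ y, gallagerTerm ρ (W.W0 y) (W.W1 y)) := rfl

lemma sum_gallagerTerm_mul_binPowerSum {ρ : ℝ} (hρ : ρ ∈ Ioo (-1 : ℝ) 0) (W : BDMC) :
    ∑ y, gallagerTerm ρ (W.W0 y) (W.W1 y) *
      binPowerSum (1 + ρ) (tiltedPosterior ρ (W.W0 y) (W.W1 y)) = 2 ^ (-ρ) := by
  simp_rw [gallagerTerm_mul_binPowerSum hρ (W.W0_nonneg _) (W.W1_nonneg _)]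
  rw [← Finset.mul_sum, Finset.sum_add_distrib, W.sum_W0, W.sum_W1,
    show -ρ = -(1 + ρ) + 1 by ring, rpow_add two_pos, rpow_one]
  norm_num

lemma sum_gallagerTerm_pos {ρ : ℝ} (hρ : ρ ∈ Ioo (-1 : ℝ) 0) (W : BDMC) :
    0 < ∑ y, gallagerTerm ρ (W.W0 y) (W.W1 y) := by
  have h0 : ∀ y, 0 ≤ gallagerTerm ρ (W.W0 y) (W.W1 y) := fun y =>
    gallagerTerm_nonneg (W.W0_nonneg y) (W.W1_nonneg y)
  refine (Finset.sum_nonneg fun y _ => h0 y).lt_of_ne' fun h => ?_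
  have hz := (Finset.sum_eq_zero_iff_of_nonneg fun y _ => h0 y).1 h
  have hs := sum_gallagerTerm_mul_binPowerSum hρ W
  rw [Finset.sum_eq_zero fun y hy => by rw [hz y hy, zero_mul]] at hs
  have : (0 : ℝ) < 2 ^ (-ρ) := by positivity
  linarith

lemma RW_eq {ρ : ℝ} (hρ : ρ ∈ Ioo (-1 : ℝ) 0) (W : BDMC) :
    RW ρ W = log 2 - (∑ y, gallagerTerm ρ (W.W0 y) (W.W1 y) *
      binEntropy (tiltedPosterior ρ (W.W0 y) (W.W1 y))) /
        ∑ y, gallagerTerm ρ (W.W0 y) (W.W1 y) := by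
  have hT := sum_gallagerTerm_pos hρ W
  have h := HasDerivAt.fun_sum (u := Finset.univ) fun y _ =>
    hasDerivAt_gallagerTerm hρ.1 (W.W0_nonneg y) (W.W1_nonneg y)
  rw [RW]
  simp_rw [E0_eq]
  rw [(h.log hT.ne').fun_neg.deriv]
  simp_rw [mul_sub]
  rw [Finset.sum_neg_distrib, Finset.sum_sub_distrib, ← Finset.sum_mul]
  field_simp

lemma E0bsc_eq (ρ : ℝ) {x : ℝ} (hx : x ∈ Icc (0 : ℝ) 1) :
    E0bsc ρ x = -log (2 * gallagerTerm ρ x (1 - x)) := by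
  have h1 : 0 ≤ x ^ (1 / (1 + ρ)) := rpow_nonneg hx.1 _
  have h2 : 0 ≤ (1 - x) ^ (1 / (1 + ρ)) := rpow_nonneg (sub_nonneg.2 hx.2) _
  rw [E0bsc, gallagerTerm, ← mul_add, mul_rpow (by norm_num) (add_nonneg h1 h2), ← mul_assoc,
    one_div 2, inv_rpow two_pos.le, ← rpow_neg two_pos.le, show -ρ = 1 + -(1 + ρ) by ring,
    rpow_add two_pos, rpow_one]

lemma two_mul_gallagerTerm_mul_binPowerSum {ρ x : ℝ} (hρ : ρ ∈ Ioo (-1 : ℝ) 0)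
    (hx : x ∈ Icc (0 : ℝ) 1) :
    2 * gallagerTerm ρ x (1 - x) * binPowerSum (1 + ρ) (tiltedPosterior ρ x (1 - x)) =
      2 ^ (-ρ) := by
  rw [mul_assoc, gallagerTerm_mul_binPowerSum hρ hx.1 (sub_nonneg.2 hx.2),
    show -ρ = 1 + -(1 + ρ) by ring, rpow_add two_pos, rpow_one]
  ring

lemma gallagerTerm_one_sub_pos {ρ x : ℝ} (hρ : ρ ∈ Ioo (-1 : ℝ) 0) (hx : x ∈ Icc (0 : ℝ) 1) :
    0 < gallagerTerm ρ x (1 - x) := by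
  refine (gallagerTerm_nonneg hx.1 (sub_nonneg.2 hx.2)).lt_of_ne' fun h => ?_
  have hs := two_mul_gallagerTerm_mul_binPowerSum hρ hx
  rw [h, mul_zero, zero_mul] at hs
  exact (rpow_pos_of_pos two_pos (-ρ)).ne hs

lemma Rbsc_eq {ρ x : ℝ} (hρ : ρ ∈ Ioo (-1 : ℝ) 0) (hx : x ∈ Icc (0 : ℝ) 1) :
    Rbsc ρ x = log 2 - binEntropy (tiltedPosterior ρ x (1 - x)) := by
  have hT := gallagerTerm_one_sub_pos hρ hx
  rw [Rbsc]
  simp_rw [E0bsc_eq _ hx]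
  rw [(((hasDerivAt_gallagerTerm hρ.1 hx.1 (sub_nonneg.2 hx.2)).const_mul 2).log
    (by positivity)).fun_neg.deriv]
  field_simp

lemma bec_sum_pos {ε : ℝ} (ρ : ℝ) (hε : ε ∈ Icc (0 : ℝ) 1) :
    0 < (2 : ℝ) ^ (-ρ) * (1 - ε) + ε := by
  have h : (0 : ℝ) < 2 ^ (-ρ) := by positivity
  rcases hε.1.eq_or_lt with rfl | h0
  · simpa
  · exact add_pos_of_nonneg_of_pos (mul_nonneg h.le (sub_nonneg.2 hε.2)) h0

lemma Rbec_eq {ρ ε : ℝ} (hε : ε ∈ Icc (0 : ℝ) 1) :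
    Rbec ρ ε = log 2 * (2 ^ (-ρ) * (1 - ε)) / (2 ^ (-ρ) * (1 - ε) + ε) := by
  have hT := bec_sum_pos ρ hε
  have h : HasDerivAt (fun r : ℝ => (2 : ℝ) ^ (-r)) (log 2 * -1 * 2 ^ (-ρ)) ρ :=
    (hasDerivAt_neg ρ).const_rpow two_pos
  rw [Rbec]
  simp_rw [E0bec]
  rw [(((h.mul_const (1 - ε)).add_const ε).log hT.ne').fun_neg.deriv]
  ring

lemma Rbec_le_RW_and_lt {W : BDMC} {ε ρ : ℝ} (hε : ε ∈ Icc (0 : ℝ) 1)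
    (hρ : ρ ∈ Ioo (-1 : ℝ) 0) :
    (E0 ρ W ≤ E0bec ρ ε → Rbec ρ ε ≤ RW ρ W) ∧
      (E0 ρ W < E0bec ρ ε → Rbec ρ ε < RW ρ W) := by
  have hr : 1 + ρ ∈ Ioo (0 : ℝ) 1 := ⟨by linarith [hρ.1], by linarith [hρ.2]⟩
  have hT := sum_gallagerTerm_pos hρ W
  have hE := bec_sum_pos ρ hε
  have hw := sum_gallagerTerm_mul_binPowerSum hρ W
  have hc := Finset.sum_le_sum (s := Finset.univ) fun y _ =>
    mul_le_mul_of_nonneg_left (binEntropy_mul_le hr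
      (tiltedPosterior_mem_Icc (ρ := ρ) (W.W0_nonneg y) (W.W1_nonneg y)))
      (gallagerTerm_nonneg (ρ := ρ) (W.W0_nonneg y) (W.W1_nonneg y))
  simp_rw [mul_left_comm (gallagerTerm _ _ _)] at hc
  rw [← Finset.mul_sum, ← Finset.mul_sum] at hc
  simp_rw [mul_sub, mul_one] at hc
  rw [Finset.sum_sub_distrib, hw, show 1 - (1 + ρ) = -ρ by ring] at hc
  have hM : (1 : ℝ) < 2 ^ (-ρ) := one_lt_rpow one_lt_two (by linarith [hρ.2])
  have hl : 0 < log 2 := log_pos one_lt_two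
  rw [E0_eq, E0bec, neg_le_neg_iff, neg_lt_neg_iff, log_le_log_iff hE hT, log_lt_log_iff hE hT,
    RW_eq hρ, Rbec_eq hε]
  set T := ∑ y, gallagerTerm ρ (W.W0 y) (W.W1 y)
  set H := ∑ y, gallagerTerm ρ (W.W0 y) (W.W1 y) *
    binEntropy (tiltedPosterior ρ (W.W0 y) (W.W1 y))
  set M : ℝ := 2 ^ (-ρ)
  set E := M * (1 - ε) + ε with hEdef
  have hH : log 2 * M * (T - 1) / ((M - 1) * T) ≤ log 2 - H / T := by
    rw [sub_div' hT.ne', div_le_div_iff₀ (mul_pos (by linarith) hT) hT]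
    nlinarith
  have hR : log 2 * (M * (1 - ε)) / E = log 2 * M * (E - 1) / ((M - 1) * E) := by
    have : E - 1 = (M - 1) * (1 - ε) := by rw [hEdef]; ring
    have : M - 1 ≠ 0 := by linarith
    rw [‹E - 1 = _›]
    field_simp
  have hd : log 2 * M * (T - 1) / ((M - 1) * T) - log 2 * M * (E - 1) / ((M - 1) * E) =
      log 2 * M / ((M - 1) * T * E) * (T - E) := by
    have : M - 1 ≠ 0 := by linarith
    field_simp
    ring
  have hpos : 0 < log 2 * M / ((M - 1) * T * E) := by
    have : 0 < M - 1 := by linarith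
    positivity
  rw [hR]
  refine ⟨fun h => ?_, fun h => ?_⟩
  · have := mul_nonneg hpos.le (sub_nonneg.2 h)
    linarith
  · have := mul_pos hpos (sub_pos.2 h)
    linarith

lemma RW_le_Rbsc_and_lt {W : BDMC} {x ρ : ℝ} (hx : x ∈ Icc (0 : ℝ) (1 / 2))
    (hρ : ρ ∈ Ioo (-1 : ℝ) 0) :
    (E0bsc ρ x ≤ E0 ρ W → RW ρ W ≤ Rbsc ρ x) ∧ (E0bsc ρ x < E0 ρ W → RW ρ W < Rbsc ρ x) := by
  have hx1 : x ∈ Icc (0 : ℝ) 1 := ⟨hx.1, by linarith [hx.2]⟩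
  have hr : 1 + ρ ∈ Ioo (0 : ℝ) 1 := ⟨by linarith [hρ.1], by linarith [hρ.2]⟩
  have hT := sum_gallagerTerm_pos hρ W
  have hB : 0 < 2 * gallagerTerm ρ x (1 - x) :=
    mul_pos two_pos (gallagerTerm_one_sub_pos hρ hx1)
  have hw := sum_gallagerTerm_mul_binPowerSum hρ W
  have hwB := two_mul_gallagerTerm_mul_binPowerSum hρ hx1
  have hM : (0 : ℝ) < 2 ^ (-ρ) := by positivity
  have h0 : ∀ y, 0 ≤ gallagerTerm ρ (W.W0 y) (W.W1 y) := fun y =>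
    gallagerTerm_nonneg (W.W0_nonneg y) (W.W1_nonneg y)
  have hp : ∀ y, tiltedPosterior ρ (W.W0 y) (W.W1 y) ∈ Icc (0 : ℝ) 1 := fun y =>
    tiltedPosterior_mem_Icc (W.W0_nonneg y) (W.W1_nonneg y)
  rw [E0_eq, E0bsc_eq ρ hx1, neg_le_neg_iff, neg_lt_neg_iff, log_le_log_iff hT hB,
    log_lt_log_iff hT hB, RW_eq hρ, Rbsc_eq hρ hx1, sub_le_sub_iff_left, sub_lt_sub_iff_left,
    le_div_iff₀ hT, lt_div_iff₀ hT]
  rcases hx.1.eq_or_lt with rfl | hx0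
  · have hp0 : tiltedPosterior ρ 0 (1 - 0) = 0 := by
      rw [tiltedPosterior, zero_rpow (one_div_ne_zero hr.1.ne'), zero_div]
    rw [hp0, binPowerSum_zero hr.1.ne', mul_one] at hwB
    rw [hp0, binEntropy_zero, zero_mul, hwB]
    have hH0 : ∀ y ∈ Finset.univ, 0 ≤ gallagerTerm ρ (W.W0 y) (W.W1 y) *
        binEntropy (tiltedPosterior ρ (W.W0 y) (W.W1 y)) := fun y _ =>
      mul_nonneg (h0 y) (binEntropy_nonneg (hp y).1 (hp y).2)
    refine ⟨fun _ => Finset.sum_nonneg hH0, fun h =>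
      (Finset.sum_nonneg hH0).lt_of_ne' fun hz => h.ne ?_⟩
    rw [← hw]
    refine Finset.sum_congr rfl fun y hy => ?_
    rcases mul_eq_zero.1 ((Finset.sum_eq_zero_iff_of_nonneg hH0).1 hz y hy) with h | h
    · rw [h, zero_mul]
    · rcases binEntropy_eq_zero.1 h with h | h
      · rw [h, binPowerSum_zero hr.1.ne', mul_one]
      · rw [h, ← binPowerSum_one_sub, sub_self, binPowerSum_zero hr.1.ne', mul_one]
  · have hp0 : tiltedPosterior ρ x (1 - x) ∈ Ioc (0 : ℝ) (1 / 2) := by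
      have h1 : 0 < x ^ (1 / (1 + ρ)) := by positivity
      have h2 : x ^ (1 / (1 + ρ)) ≤ (1 - x) ^ (1 / (1 + ρ)) :=
        rpow_le_rpow hx0.le (by linarith [hx.2]) (one_div_nonneg.2 hr.1.le)
      have h3 := h1.trans_le h2
      rw [tiltedPosterior]
      refine ⟨by positivity, ?_⟩
      rw [div_le_iff₀ (by positivity)]
      linarith
    obtain ⟨m, hm, h⟩ := exists_binEntropy_support hr hp0
    have hs := Finset.sum_le_sum (s := Finset.univ) fun y _ =>
      mul_le_mul_of_nonneg_left (h _ (hp y)) (h0 y)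
    simp_rw [mul_add, mul_left_comm _ m, mul_sub] at hs
    rw [Finset.sum_add_distrib, Finset.sum_sub_distrib, ← Finset.sum_mul, ← Finset.mul_sum,
      ← Finset.mul_sum, hw, ← Finset.sum_mul] at hs
    have hw0 : 0 < binPowerSum (1 + ρ) (tiltedPosterior ρ x (1 - x)) := by
      rw [← hwB] at hM
      exact (mul_pos_iff_of_pos_left hB).1 hM
    rw [← hwB] at hs
    refine ⟨fun h => ?_, fun h => ?_⟩
    · have := mul_le_mul_of_nonneg_left h (mul_pos hm hw0).le
      linarith
    · have := mul_lt_mul_of_pos_left h (mul_pos hm hw0)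
      linarith

/-- Lemma 8: for `ρ ∈ (−1,0)`, if `E₀(ρ, BSC_x) ≤ E₀(ρ, W) ≤ E₀(ρ, BEC_ε)` then
`R(ρ, BEC_ε) ≤ R(ρ, W) ≤ R(ρ, BSC_x)`, strictly whenever both hypotheses are strict. -/
theorem rate_extremality_neg (W : BDMC) (ε x ρ : ℝ)
    (hε : ε ∈ Set.Icc (0:ℝ) 1) (hx : x ∈ Set.Icc (0:ℝ) (1/2))
    (hρ : ρ ∈ Set.Ioo (-1:ℝ) 0)
    (hBSC : E0bsc ρ x ≤ E0 ρ W) (hBEC : E0 ρ W ≤ E0bec ρ ε) :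
    (Rbec ρ ε ≤ RW ρ W ∧ RW ρ W ≤ Rbsc ρ x) ∧
    (E0bsc ρ x < E0 ρ W → E0 ρ W < E0bec ρ ε →
      Rbec ρ ε < RW ρ W ∧ RW ρ W < Rbsc ρ x) := by
  exact ⟨⟨(Rbec_le_RW_and_lt hε hρ).1 hBEC, (RW_le_Rbsc_and_lt hx hρ).1 hBSC⟩, fun hB hE =>
    ⟨(Rbec_le_RW_and_lt hε hρ).2 hE, (RW_le_Rbsc_and_lt hx hρ).2 hB⟩⟩
end

section
/- (Appendix Lemma on the sign of m.) Fix k ∈ (0, 1]. Then: (i) m(k, ρ) ≥ 0 for all ρ < −1; (ii) m(k, ρ) ≤ 0 for all ρ ∈ (−1, 0); (iii) m(k, 0) = 0; (iv) there exists ρ* ≥ 3 (depending on k) such that m(k, ρ) ≤ 0 for all ρ ∈ (−1, ρ*), m(k, ρ*) = 0, and m(k, ρ) ≥ 0 for all ρ > ρ*. -/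
/-- The function `m(k, ρ) = −1 + k − k^{1/(1+ρ)} + k^{ρ/(1+ρ)}
− (k^{ρ/(1+ρ)} + k^{1/(1+ρ)})·(ρ/(1+ρ))·log k`, with real powers and natural log. -/
noncomputable def m (k ρ : ℝ) : ℝ :=
  -1 + k - k ^ (1/(1+ρ)) + k ^ (ρ/(1+ρ)) -
    (k ^ (ρ/(1+ρ)) + k ^ (1/(1+ρ))) * (ρ/(1+ρ)) * Real.log k

/-- Up to a positive factor, `m (exp (-2 * a)) ρ` is `signFun a (a * (2 * (ρ / (1 + ρ)) - 1))`. -/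
noncomputable def signFun (a x : ℝ) : ℝ :=
  (x + a) * Real.cosh x - Real.sinh x - Real.sinh a

lemma hasDerivAt_signFun (a x : ℝ) :
    HasDerivAt (signFun a) ((x + a) * Real.sinh x) x := by
  have h := ((((hasDerivAt_id x).add_const a).mul (Real.hasDerivAt_cosh x)).sub
    (Real.hasDerivAt_sinh x)).sub_const (Real.sinh a)
  refine h.congr_deriv ?_
  simp

lemma continuous_signFun (a : ℝ) : Continuous (signFun a) := by
  unfold signFun
  fun_prop

lemma signFun_neg_self (a : ℝ) : signFun a (-a) = 0 := by
  simp [signFun]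

lemma strictMonoOn_signFun {a : ℝ} (ha : 0 ≤ a) : StrictMonoOn (signFun a) (Set.Ici 0) := by
  refine strictMonoOn_of_deriv_pos (convex_Ici 0) (continuous_signFun a).continuousOn ?_
  intro x hx
  rw [interior_Ici, Set.mem_Ioi] at hx
  rw [(hasDerivAt_signFun a x).deriv]
  have := Real.sinh_pos_iff.2 hx
  positivity

lemma antitoneOn_signFun (a : ℝ) : AntitoneOn (signFun a) (Set.Icc (-a) 0) := by
  refine antitoneOn_of_deriv_nonpos (convex_Icc _ _) (continuous_signFun a).continuousOn
    (fun x _ => (hasDerivAt_signFun a x).differentiableAt.differentiableWithinAt) ?_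
  intro x hx
  rw [interior_Icc] at hx
  rw [(hasDerivAt_signFun a x).deriv]
  exact mul_nonpos_of_nonneg_of_nonpos (by linarith [hx.1]) (Real.sinh_nonpos_iff.2 hx.2.le)

lemma monotoneOn_signFun {a : ℝ} (ha : 0 ≤ a) : MonotoneOn (signFun a) (Set.Iic (-a)) := by
  refine monotoneOn_of_deriv_nonneg (convex_Iic _) (continuous_signFun a).continuousOn
    (fun x _ => (hasDerivAt_signFun a x).differentiableAt.differentiableWithinAt) ?_
  intro x hx
  rw [interior_Iic, Set.mem_Iio] at hx
  rw [(hasDerivAt_signFun a x).deriv]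
  exact mul_nonneg_of_nonpos_of_nonpos (by linarith) (Real.sinh_nonpos_iff.2 (by linarith))

lemma signFun_self_pos {a : ℝ} (ha : 0 < a) : 0 < signFun a a := by
  have h := strictMonoOn_signFun le_rfl Set.self_mem_Ici (Set.mem_Ici.2 ha.le) ha
  simp only [signFun, Real.cosh_zero, Real.sinh_zero] at h ⊢
  linarith

lemma three_mul_mul_cosh_le {b : ℝ} (hb : 0 ≤ b) :
    3 * b * Real.cosh b ≤ Real.sinh b * (1 + 2 * Real.cosh b) := by
  have hd (x : ℝ) : HasDerivAt
      (fun x => 2 * Real.sinh x + Real.sinh x / Real.cosh x - 3 * x)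
      (2 * Real.cosh x + (Real.cosh x * Real.cosh x - Real.sinh x * Real.sinh x) /
        Real.cosh x ^ 2 - 3 * 1) x :=
    (((Real.hasDerivAt_sinh x).const_mul 2).add ((Real.hasDerivAt_sinh x).div
      (Real.hasDerivAt_cosh x) (Real.cosh_pos x).ne')).sub ((hasDerivAt_id x).const_mul 3)
  have hmono := monotone_of_hasDerivAt_nonneg hd (fun x => by
    have h1 := Real.one_le_cosh x
    have h2 : Real.cosh x * Real.cosh x - Real.sinh x * Real.sinh x = 1 := by
      linarith [Real.cosh_sq_sub_sinh_sq x]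
    have h3 : 2 * Real.cosh x + 1 / Real.cosh x ^ 2 - 3 * 1 =
        (Real.cosh x - 1) ^ 2 * (2 * Real.cosh x + 1) / Real.cosh x ^ 2 := by
      field_simp
      ring
    rw [h2, h3]
    simp only [Pi.zero_apply]
    positivity)
  have h := hmono hb
  simp only [Real.sinh_zero, mul_zero, zero_div, add_zero, sub_zero] at h
  have hc := Real.cosh_pos b
  have h4 : Real.sinh b / Real.cosh b * Real.cosh b = Real.sinh b := by field_simp
  nlinarith [mul_nonneg h hc.le]

lemma signFun_half_nonpos {a : ℝ} (ha : 0 ≤ a) : signFun a (a / 2) ≤ 0 := by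
  have h := three_mul_mul_cosh_le (b := a / 2) (by linarith)
  have h2 : Real.sinh a = 2 * Real.sinh (a / 2) * Real.cosh (a / 2) := by
    rw [← Real.sinh_two_mul]
    congr 1
    ring
  unfold signFun
  rw [h2]
  linarith

lemma m_exp_eq (a : ℝ) {ρ : ℝ} (hρ : 1 + ρ ≠ 0) :
    m (Real.exp (-2 * a)) ρ =
      2 * Real.exp (-a) * signFun a (a * (2 * (ρ / (1 + ρ)) - 1)) := by
  have h1 : 1 / (1 + ρ) = 1 - ρ / (1 + ρ) := by
    field_simp
    ring
  unfold m signFun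
  rw [h1]
  set t := ρ / (1 + ρ)
  have e1 : Real.exp (-2 * a) ^ t = Real.exp (-a) * Real.exp (-(a * (2 * t - 1))) := by
    rw [← Real.exp_mul, ← Real.exp_add]
    congr 1
    ring
  have e2 : Real.exp (-2 * a) ^ (1 - t) = Real.exp (-a) * Real.exp (a * (2 * t - 1)) := by
    rw [← Real.exp_mul, ← Real.exp_add]
    congr 1
    ring
  have e3 : Real.exp (-2 * a) = Real.exp (-a) * Real.exp (-a) := by
    rw [← Real.exp_add]
    congr 1
    ring
  have e4 : Real.exp (-a) * Real.exp a = 1 := by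
    rw [← Real.exp_add]
    simp
  rw [e1, e2, Real.log_exp, e3, Real.cosh_eq, Real.sinh_eq, Real.sinh_eq]
  linear_combination e4

lemma m_one (ρ : ℝ) : m 1 ρ = 0 := by
  simp [m]

/-- Appendix lemma on the sign of `m`: for `k ∈ (0,1]`, `m(k, ·)` is nonnegative on
`(−∞, −1)`, nonpositive on `(−1, 0)`, vanishes at `0`, and there is a `ρ* ≥ 3` such
that `m(k, ·)` is nonpositive on `(−1, ρ*)`, vanishes at `ρ*`, and is nonnegative on
`(ρ*, ∞)`. -/
theorem sign_of_m (k : ℝ) (hk : k ∈ Set.Ioc (0:ℝ) 1) :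
    (∀ ρ : ℝ, ρ < -1 → 0 ≤ m k ρ) ∧
    (∀ ρ ∈ Set.Ioo (-1:ℝ) 0, m k ρ ≤ 0) ∧
    m k 0 = 0 ∧
    ∃ ρs : ℝ, 3 ≤ ρs ∧
      (∀ ρ ∈ Set.Ioo (-1:ℝ) ρs, m k ρ ≤ 0) ∧
      m k ρs = 0 ∧
      (∀ ρ : ℝ, ρs < ρ → 0 ≤ m k ρ) := by
  obtain ⟨hk0, hk1⟩ := hk
  rcases hk1.eq_or_lt with rfl | hk1
  · simp only [m_one, le_refl, implies_true, true_and, and_true]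
    exact ⟨3, le_rfl⟩
  obtain ⟨a, ha, rfl⟩ : ∃ a : ℝ, 0 < a ∧ k = Real.exp (-2 * a) := by
    refine ⟨-Real.log k / 2, by linarith [Real.log_neg hk0 hk1], ?_⟩
    rw [show -2 * (-Real.log k / 2) = Real.log k by ring, Real.exp_log hk0]
  have hE : 0 < 2 * Real.exp (-a) := by positivity
  have hfrac {ρ : ℝ} (hρ : 1 + ρ ≠ 0) : ρ / (1 + ρ) = 1 - 1 / (1 + ρ) := by
    field_simp
    ring
  have hmono := (strictMonoOn_signFun ha.le).monotoneOn
  obtain ⟨x, ⟨hx1, hx2⟩, hx0⟩ := intermediate_value_Icc (by linarith : a / 2 ≤ a)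
    (continuous_signFun a).continuousOn ⟨signFun_half_nonpos ha.le, (signFun_self_pos ha).le⟩
  have hxa : x < a := lt_of_le_of_ne hx2 fun h =>
    (signFun_self_pos ha).ne' (h ▸ hx0)
  have hxnn : x ∈ Set.Ici (0 : ℝ) := Set.mem_Ici.2 (by linarith)
  have hnonpos {y : ℝ} (hy : y ≤ x) : signFun a y ≤ 0 := by
    rcases le_total y (-a) with h | h
    · exact (monotoneOn_signFun ha.le h Set.self_mem_Iic h).trans_eq (signFun_neg_self a)
    rcases le_total y 0 with h' | h'
    · exact (antitoneOn_signFun a ⟨le_rfl, by linarith⟩ ⟨h, h'⟩ h).trans_eq (signFun_neg_self a)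
    · exact (hmono h' hxnn hy).trans_eq hx0
  have hnonneg {y : ℝ} (hy : x ≤ y) : 0 ≤ signFun a y :=
    hx0.symm.trans_le (hmono hxnn (hxnn.trans hy) hy)
  have hd : 0 < a - x := by linarith
  have hs : 3 ≤ (a + x) / (a - x) := by
    rw [le_div_iff₀ hd]
    linarith
  have hs1 : 1 + (a + x) / (a - x) = 2 * a / (a - x) := by
    field_simp
    ring
  have hsx : a * (2 * ((a + x) / (a - x) / (1 + (a + x) / (a - x))) - 1) = x := by
    rw [hs1]
    field_simp
    ring
  have hle {ρ σ : ℝ} (hρ : -1 < ρ) (h : ρ ≤ σ) :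
      a * (2 * (ρ / (1 + ρ)) - 1) ≤ a * (2 * (σ / (1 + σ)) - 1) := by
    have hρ' : 0 < 1 + ρ := by linarith
    rw [hfrac hρ'.ne', hfrac (by linarith : 0 < 1 + σ).ne']
    gcongr
  have hlow (ρ : ℝ) (hρ : ρ ∈ Set.Ioo (-1 : ℝ) ((a + x) / (a - x))) :
      m (Real.exp (-2 * a)) ρ ≤ 0 := by
    rw [m_exp_eq a (by linarith [hρ.1] : 0 < 1 + ρ).ne']
    exact mul_nonpos_of_nonneg_of_nonpos hE.le (hnonpos ((hle hρ.1 hρ.2.le).trans_eq hsx))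
  refine ⟨fun ρ hρ => ?_, fun ρ hρ => hlow ρ ⟨hρ.1, by linarith [hρ.2]⟩, ?_, _, hs, hlow, ?_,
    fun ρ hρ => ?_⟩
  · have hne : 1 + ρ ≠ 0 := (by linarith : 1 + ρ < 0).ne
    rw [m_exp_eq a hne]
    refine mul_nonneg hE.le (hnonneg (hx2.trans ?_))
    rw [hfrac hne]
    have : 1 / (1 + ρ) < 0 := one_div_neg.2 (by linarith)
    nlinarith
  · simp [m]
  · rw [m_exp_eq a (by linarith : 0 < 1 + (a + x) / (a - x)).ne', hsx, hx0, mul_zero]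
  · rw [m_exp_eq a (by linarith : 0 < 1 + ρ).ne']
    exact mul_nonneg hE.le (hnonneg (hsx.symm.trans_le (hle (by linarith) hρ.le)))
end

section
/- (Appendix Lemma on monotonicity of F.) Fix k ∈ (0, 1). The function ρ ↦ F(k, ρ) is nonincreasing on (0, 1]: for all ρ₁, ρ₂ with 0 < ρ₁ ≤ ρ₂ ≤ 1, one has F(k, ρ₂) ≤ F(k, ρ₁). -/
/-- The function `F(k, ρ) = (ρ/(1+ρ)) · ((1+k)/k) · 1/((1 + k^{1/(1+ρ)})(k^{ρ/(1+ρ)} − 1))`,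
with real powers. -/
noncomputable def F (k ρ : ℝ) : ℝ :=
  (ρ/(1+ρ)) * ((1+k)/k) * (1 / ((1 + k ^ (1/(1+ρ))) * (k ^ (ρ/(1+ρ)) - 1)))

/-- The denominator of `F`, up to sign, in the variable `s = ρ/(1+ρ)`, is concave
on `[0, 1/2]`. -/
theorem concaveOn_one_add_rpow_mul_one_sub_rpow {k : ℝ} (hk : k ∈ Set.Ioo (0:ℝ) 1) :
    ConcaveOn ℝ (Set.Icc 0 (1/2)) fun s : ℝ => (1 + k ^ (1 - s)) * (1 - k ^ s) := by
  obtain ⟨h0, h1⟩ := hk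
  have hexp : (fun s : ℝ => (1 + k ^ (1 - s)) * (1 - k ^ s)) =
      fun s => 1 - k + (k ^ (1 - s) - k ^ s) := by
    funext s
    have h : k ^ (1 - s) * k ^ s = k := by
      rw [← Real.rpow_add h0, sub_add_cancel, Real.rpow_one]
    linear_combination -h
  have hd (s : ℝ) : HasDerivAt (fun s : ℝ => k ^ s) (k ^ s * Real.log k) s := by
    simpa [mul_comm] using (hasDerivAt_id s).const_rpow h0
  have hd' (s : ℝ) : HasDerivAt (fun s : ℝ => k ^ (1 - s)) (-(k ^ (1 - s) * Real.log k)) s := by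
    simpa [mul_comm] using ((hasDerivAt_id s).const_sub 1).const_rpow h0
  have hD (s : ℝ) : HasDerivAt (fun s : ℝ => 1 - k + (k ^ (1 - s) - k ^ s))
      (-(k ^ (1 - s) * Real.log k) - k ^ s * Real.log k) s :=
    ((hd' s).sub (hd s)).const_add _
  have hD' (s : ℝ) : HasDerivAt (fun s : ℝ => -(k ^ (1 - s) * Real.log k) - k ^ s * Real.log k)
      (-(-(k ^ (1 - s) * Real.log k) * Real.log k) - k ^ s * Real.log k * Real.log k) s :=
    (((hd' s).mul_const _).neg).sub ((hd s).mul_const _)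
  rw [hexp]
  refine concaveOn_of_hasDerivWithinAt2_nonpos (convex_Icc _ _)
    (fun s _ => (hD s).continuousAt.continuousWithinAt)
    (fun s _ => (hD s).hasDerivWithinAt) (fun s _ => (hD' s).hasDerivWithinAt) ?_
  intro s hs
  rw [interior_Icc] at hs
  have hle : k ^ (1 - s) ≤ k ^ s :=
    Real.rpow_le_rpow_of_exponent_ge h0 h1.le (by linarith [hs.2])
  nlinarith [mul_nonneg (sub_nonneg.2 hle) (sq_nonneg (Real.log k))]

/-- The quotient appearing in `-F` is nondecreasing in `s = ρ/(1+ρ)`. -/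
theorem monotoneOn_div_one_add_rpow_mul_one_sub_rpow {k : ℝ} (hk : k ∈ Set.Ioo (0:ℝ) 1) :
    MonotoneOn (fun s : ℝ => s / ((1 + k ^ (1 - s)) * (1 - k ^ s))) (Set.Ioc 0 (1/2)) := by
  intro s hs t ht hst
  have hpos {u : ℝ} (hu : 0 < u) : 0 < (1 + k ^ (1 - u)) * (1 - k ^ u) :=
    mul_pos (by linarith [Real.rpow_pos_of_pos hk.1 (1 - u)])
      (sub_pos.2 (Real.rpow_lt_one hk.1.le hk.2 hu))
  have ht0 : t ≠ 0 := ht.1.ne'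
  have h := (concaveOn_one_add_rpow_mul_one_sub_rpow hk).2
    (Set.left_mem_Icc.2 (by norm_num)) (Set.Ioc_subset_Icc_self ht)
    (sub_nonneg.2 ((div_le_one ht.1).2 hst)) (div_nonneg hs.1.le ht.1.le) (sub_add_cancel _ _)
  simp only [smul_eq_mul, mul_zero, zero_add, div_mul_cancel₀ s ht0, Real.rpow_zero,
    sub_self] at h
  rw [div_mul_eq_mul_div, div_le_iff₀ ht.1] at h
  simp only
  rw [div_le_div_iff₀ (hpos hs.1) (hpos ht.1)]
  linarith

theorem F_eq_neg_mul_div (k : ℝ) {ρ : ℝ} (hρ : 0 < ρ) :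
    F k ρ = -((1 + k) / k * (ρ / (1 + ρ) /
      ((1 + k ^ (1 - ρ / (1 + ρ))) * (1 - k ^ (ρ / (1 + ρ)))))) := by
  have h : 1 / (1 + ρ) = 1 - ρ / (1 + ρ) := by
    field_simp
    ring
  rw [F, h, ← neg_sub 1 (k ^ (ρ / (1 + ρ))), mul_neg, one_div, inv_neg]
  ring

/-- Appendix lemma: for fixed `k ∈ (0,1)`, the function `ρ ↦ F(k, ρ)` is nonincreasing
on `(0,1]`. -/
theorem F_antitone (k : ℝ) (hk : k ∈ Set.Ioo (0:ℝ) 1) :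
    ∀ ρ₁ ρ₂ : ℝ, 0 < ρ₁ → ρ₁ ≤ ρ₂ → ρ₂ ≤ 1 → F k ρ₂ ≤ F k ρ₁ := by
  intro ρ₁ ρ₂ h1 h12 h2
  have hρ₂ : 0 < ρ₂ := h1.trans_le h12
  have hmem {ρ : ℝ} (hρ : 0 < ρ) (hρ1 : ρ ≤ 1) : ρ / (1 + ρ) ∈ Set.Ioc (0:ℝ) (1/2) :=
    ⟨by positivity, by rw [div_le_div_iff₀ (by positivity) two_pos]; linarith⟩
  have hle : ρ₁ / (1 + ρ₁) ≤ ρ₂ / (1 + ρ₂) := by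
    rw [div_le_div_iff₀ (by positivity) (by positivity)]
    linarith
  have hc : 0 ≤ (1 + k) / k := div_nonneg (by linarith [hk.1]) hk.1.le
  rw [F_eq_neg_mul_div k h1, F_eq_neg_mul_div k hρ₂]
  exact neg_le_neg (mul_le_mul_of_nonneg_left
    (monotoneOn_div_one_add_rpow_mul_one_sub_rpow hk (hmem h1 (h12.trans h2)) (hmem hρ₂ h2) hle) hc)
end
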